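/- Let D ∈ W_1 (the degree-1 component of the Witt superalgebra). Then [x_1∂_j, D] = 0 for all j ≥ 2 if and only if D = λ·x_1𝔇 + x_1^2·Σ_{j≥2} k_j ∂_j for some scalars λ, k_j ∈ F. -/

import Mathlib

open Finset

namespace Cartan

/-- Monomial index set for the divided power superalgebra `O(m,n)`:
a multi-exponent `α : Fin m → Fin p` (divided powers truncated at `p-1`)
together with a subset of the odd variables. -/
abbrev Mon (p m n : ℕ) := (Fin m → Fin p) × Finset (Fin n)

/-- The divided power superalgebra `O(m,n)` realized as coefficient functions on monomials. -/
abbrev O (F : Type*) [Field F] (p m n : ℕ) := Mon p m n → F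

/-- The Witt superalgebra `W(m,n)` realized as tuples of coefficients:
`D : W` represents `∑ i, D i · ∂ i`. -/
abbrev W (F : Type*) [Field F] (p m n : ℕ) := Fin (m + n) → O F p m n

variable {F : Type*} [Field F] {p m n : ℕ}

/-- `ℤ₂`-parity of a monomial. -/
def parMon (μ : Mon p m n) : ZMod 2 := (μ.2.card : ZMod 2)

/-- `ℤ`-degree of a monomial (each variable has degree 1). -/
def zdMon (μ : Mon p m n) : ℕ := (∑ i, (μ.1 i : ℕ)) + μ.2.card

/-- Parity of the index `i`: even if `i < m`, odd otherwise. -/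
def parIdx (m : ℕ) {k : ℕ} (i : Fin k) : ZMod 2 := if (i : ℕ) < m then 0 else 1

/-- The constant function `1 ∈ O(m,n)`. -/
def oneO (F : Type*) [Field F] (p m n : ℕ) [NeZero p] : O F p m n :=
  fun μ => if μ.1 = 0 ∧ μ.2 = (∅ : Finset (Fin n)) then 1 else 0

/-- Koszul sign for multiplying exterior monomials `x^s · x^t`. -/
def extSign {n : ℕ} (s t : Finset (Fin n)) : ℤ :=
  (-1) ^ ∑ i ∈ t, (s.filter fun j => i < j).card

/-- Multiplication of the divided power superalgebra `O(m,n)`: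
`x^(α)x^u · x^(β)x^v = (Koszul sign) · ∏ binom(α+β,α) · x^(α+β) x^(u∪v)`. -/
def mulO [NeZero p] (f g : O F p m n) : O F p m n := fun μ =>
  ∑ ν : Mon p m n, ∑ κ : Mon p m n,
    if (∀ i, (ν.1 i : ℕ) + (κ.1 i : ℕ) = (μ.1 i : ℕ)) ∧ ν.2 ∩ κ.2 = ∅ ∧ ν.2 ∪ κ.2 = μ.2 then
      ((extSign ν.2 κ.2 : ℤ) : F) * (∏ i, (((μ.1 i : ℕ).choose (ν.1 i : ℕ) : ℕ) : F))
        * f ν * g κ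
    else 0

/-- The even partial superderivation `∂_i`, `i ≤ m`, on `O(m,n)`. -/
def dEv [NeZero p] (i : Fin m) (f : O F p m n) : O F p m n := fun μ =>
  if h : (μ.1 i : ℕ) + 1 < p then f (Function.update μ.1 i ⟨(μ.1 i : ℕ) + 1, h⟩, μ.2) else 0

/-- The odd partial superderivation `∂_{m+i}` on `O(m,n)`. -/
def dOd (i : Fin n) (f : O F p m n) : O F p m n := fun μ =>
  if i ∈ μ.2 then 0
  else ((-1 : F)) ^ (μ.2.filter fun j => j < i).card * f (μ.1, insert i μ.2)

/-- The partial superderivation `∂_i`, `i ∈ I = {1,…,m+n}`. -/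
def pd [NeZero p] (i : Fin (m + n)) (f : O F p m n) : O F p m n :=
  Sum.elim (fun j => dEv j f) (fun j => dOd j f) (finSumFinEquiv.symm i)

/-- The variable `x_i` as an element of `O(m,n)`. -/
def xVar [NeZero p] (i : Fin (m + n)) : O F p m n := fun μ =>
  if h : (i : ℕ) < m then
    (if μ.1 = Pi.single (⟨i, h⟩ : Fin m) 1 ∧ μ.2 = (∅ : Finset (Fin n)) then 1 else 0)
  else
    (if μ.1 = 0 ∧ μ.2 = {(⟨(i : ℕ) - m, by have := i.isLt; omega⟩ : Fin n)} then 1 else 0)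

/-- Projection of `f ∈ O(m,n)` onto its parity-`b` component. -/
def projO (b : ZMod 2) (f : O F p m n) : O F p m n :=
  fun μ => if parMon μ = b then f μ else 0

/-- Projection of `D ∈ W(m,n)` onto its parity-`b` component
(the parity of `f ∂_i` is `|f| + |∂_i|`). -/
def projW (b : ZMod 2) (D : W F p m n) : W F p m n :=
  fun i => projO (b + parIdx m i) (D i)

/-- `f` is `ℤ₂`-homogeneous of parity `b`. -/
def isParO (b : ZMod 2) (f : O F p m n) : Prop := ∀ μ, f μ ≠ 0 → parMon μ = b

/-- `D` is `ℤ₂`-homogeneous of parity `b`. -/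
def isParW (b : ZMod 2) (D : W F p m n) : Prop := ∀ i, isParO (b + parIdx m i) (D i)

/-- Action of a superderivation `D = ∑ f_i ∂_i` on `g ∈ O(m,n)`: `D(g) = ∑ f_i · ∂_i(g)`. -/
def act [NeZero p] (D : W F p m n) (g : O F p m n) : O F p m n :=
  ∑ i, mulO (D i) (pd i g)

/-- Super-commutator bracket on `W(m,n)`, extended bilinearly from homogeneous components:
`[D,E] = D∘E - (-1)^{|D||E|} E∘D`, recorded via values on the generators `x_k`. -/
def bracketW [NeZero p] (D E : W F p m n) : W F p m n :=
  ∑ a : ZMod 2, ∑ b : ZMod 2,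
    (fun k => act (projW a D) (projW b E k)
      - ((-1 : F)) ^ (a * b).val • act (projW b E) (projW a D k) : W F p m n)

/-- Divergence: `div(f ∂_i) = (-1)^{|f||∂_i|} ∂_i(f)`, extended linearly. -/
def divW [NeZero p] (D : W F p m n) : O F p m n :=
  ∑ i, ∑ b : ZMod 2, ((-1 : F)) ^ (b * parIdx m i).val • pd i (projO b (D i))

/-- The Euler (degree) derivation `𝔇 = ∑ x_k ∂_k`. -/
def euler (F : Type*) [Field F] (p m n : ℕ) [NeZero p] : W F p m n := fun i => xVar i

/-- The derivation `f𝔇 = ∑ (f·x_k) ∂_k`. -/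
def fEuler [NeZero p] (f : O F p m n) : W F p m n := fun i => mulO f (xVar i)

/-- `f` is `ℤ`-homogeneous of degree `s` (i.e. `f ∈ O_s`). -/
def inO (s : ℤ) (f : O F p m n) : Prop := ∀ μ, f μ ≠ 0 → (zdMon μ : ℤ) = s

/-- `D ∈ W_s` for the standard grading (`zd(f∂_i) = zd(f) - 1`). -/
def inW (s : ℤ) (D : W F p m n) : Prop := ∀ i, inO (s + 1) (D i)

/-- The superderivation `∂_i` as an element of `W(m,n)`. -/
def delOp (F : Type*) [Field F] (p m n : ℕ) [NeZero p] (i : Fin (m + n)) : W F p m n :=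
  fun k => if k = i then oneO F p m n else 0

/-- The `ℤ`-graded component `W_s` as a submodule. -/
def Wgrade (F : Type*) [Field F] (p m n : ℕ) (s : ℤ) : Submodule F (W F p m n) where
  carrier := {D | inW s D}
  add_mem' := by
    intro a b ha hb i μ h
    by_cases h1 : a i μ = 0
    · exact hb i μ (by simpa [h1] using h)
    · exact ha i μ h1
  zero_mem' := by intro i μ h; simp at h
  smul_mem' := by
    intro c a ha i μ h
    refine ha i μ (fun h1 => h ?_)
    simp [h1]


section Helpers

variable [NeZero p]

lemma val_one_fin (hp : 3 < p) : ((1 : Fin p) : ℕ) = 1 := by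
  rw [Fin.val_one']; exact Nat.mod_eq_of_lt (by omega)

lemma val_sub_one_fin (hp : 3 < p) (a : Fin p) (h : (a : ℕ) ≠ 0) :
    ((a - 1 : Fin p) : ℕ) = a - 1 := by
  rw [Fin.sub_val_of_le]
  · rw [val_one_fin hp]
  · rw [Fin.le_def, val_one_fin hp]; omega

/-- The exponent monomial of the variable `x_1`. -/
lemma xVar_zero (hm : 0 < m) (h : 0 < m + n) (μ : Mon p m n) :
    (xVar (⟨0, h⟩ : Fin (m + n)) : O F p m n) μ =
      if μ = (Pi.single (⟨0, hm⟩ : Fin m) 1, ∅) then 1 else 0 := by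
  simp [xVar, hm, Prod.ext_iff]

lemma xVar_castAdd (i : Fin m) (μ : Mon p m n) :
    (xVar (Fin.castAdd n i) : O F p m n) μ = if μ = (Pi.single i 1, ∅) then 1 else 0 := by
  simp [xVar, Prod.ext_iff]

lemma xVar_natAdd (i : Fin n) (μ : Mon p m n) :
    (xVar (Fin.natAdd m i) : O F p m n) μ = if μ = (0, {i}) then 1 else 0 := by
  simp [xVar, Prod.ext_iff]

lemma pd_castAdd (i : Fin m) (f : O F p m n) : pd (Fin.castAdd n i) f = dEv i f := by
  simp [pd]

lemma pd_natAdd (i : Fin n) (f : O F p m n) : pd (Fin.natAdd m i) f = dOd i f := by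
  simp [pd]

lemma mulO_zero (f : O F p m n) : mulO f 0 = 0 := by
  funext μ; simp [mulO]

lemma zero_mulO (f : O F p m n) : mulO 0 f = 0 := by
  funext μ; simp [mulO]

lemma mulO_one (f : O F p m n) : mulO f (oneO F p m n) = f := by
  funext μ
  unfold mulO
  rw [Finset.sum_eq_single μ]
  · rw [Finset.sum_eq_single ((0, ∅) : Mon p m n)]
    · simp [oneO, extSign]
    · intro κ _ hκ
      have : oneO F p m n κ = 0 := by
        simp only [oneO]; rw [if_neg]; rintro ⟨h1, h2⟩; exact hκ (Prod.ext h1 h2)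
      simp [this]
    · simp
  · intro ν _ hν
    apply Finset.sum_eq_zero
    intro κ _
    split_ifs with h
    · have : oneO F p m n κ = 0 := by
        simp only [oneO]; rw [if_neg]; rintro ⟨h1, h2⟩
        apply hν
        obtain ⟨ha, -, hb⟩ := h
        refine Prod.ext (funext fun i => Fin.ext ?_) ?_
        · have := ha i; simpa [h1] using this
        · simpa [h2] using hb
      simp [this]
    · rfl
  · simp

lemma mulO_x (hp : 3 < p) (hm : 0 < m) (h : 0 < m + n) (f : O F p m n) (μ : Mon p m n) :
    mulO (xVar (⟨0, h⟩ : Fin (m + n))) f μ = ((μ.1 ⟨0, hm⟩ : ℕ) : F) *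
      f (Function.update μ.1 ⟨0, hm⟩ (μ.1 ⟨0, hm⟩ - 1), μ.2) := by
  have v1' := val_one_fin hp
  have v1 : 1 % p = 1 := Nat.mod_eq_of_lt (by omega)
  set i0 : Fin m := ⟨0, hm⟩ with hi0
  unfold mulO
  rw [Finset.sum_eq_single ((Pi.single i0 1, ∅) : Mon p m n)]
  · rw [Finset.sum_eq_single ((Function.update μ.1 i0 (μ.1 i0 - 1), μ.2) : Mon p m n)]
    · rw [xVar_zero hm h, if_pos rfl]
      by_cases h0 : (μ.1 i0 : ℕ) = 0
      · rw [if_neg]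
        · simp [h0]
        · rintro ⟨ha, -⟩
          have := ha i0
          simp [v1] at this
          omega
      · rw [if_pos]
        · have : (∏ i, (((μ.1 i : ℕ).choose ((Pi.single i0 1 : Fin m → Fin p) i : ℕ) : ℕ) : F))
              = ((μ.1 i0 : ℕ) : F) := by
            rw [Finset.prod_eq_single i0]
            · simp [v1]
            · intro b _ hb; simp [hb]
            · simp
          rw [this]; simp [extSign]
        · refine ⟨fun i => ?_, by simp, by simp⟩
          by_cases hi : i = i0
          · subst hi
            simp [v1, val_sub_one_fin hp _ h0]; omega
          · simp [hi]
    · intro κ _ hκ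
      rw [if_neg]
      rintro ⟨ha, -, hb⟩
      apply hκ
      refine Prod.ext (funext fun i => Fin.ext ?_) (by simpa using hb)
      have := ha i
      by_cases hi : i = i0
      · subst hi
        simp only [Pi.single_eq_same, v1', Function.update_self] at this ⊢
        rw [val_sub_one_fin hp _ (by omega)]; omega
      · simpa [hi] using this
    · simp
  · intro ν _ hν
    apply Finset.sum_eq_zero
    intro κ _
    rw [xVar_zero hm h, if_neg hν]; simp
  · simp

lemma mulO_x_add (hp : 3 < p) (hm : 0 < m) (h : 0 < m + n) (f g : O F p m n) :
    mulO (xVar (⟨0, h⟩ : Fin (m + n))) (f + g) =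
      mulO (xVar (⟨0, h⟩ : Fin (m + n))) f + mulO (xVar (⟨0, h⟩ : Fin (m + n))) g := by
  funext μ
  simp only [mulO_x hp hm h, Pi.add_apply]; ring

lemma mulO_x_smul (hp : 3 < p) (hm : 0 < m) (h : 0 < m + n) (c : F) (g : O F p m n) :
    mulO (xVar (⟨0, h⟩ : Fin (m + n))) (c • g) =
      c • mulO (xVar (⟨0, h⟩ : Fin (m + n))) g := by
  funext μ
  simp only [mulO_x hp hm h, Pi.smul_apply, smul_eq_mul]; ring

lemma pd_add (i : Fin (m + n)) (f g : O F p m n) : pd i (f + g) = pd i f + pd i g := by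
  funext μ
  refine Fin.addCases (fun i => ?_) (fun i => ?_) i
  · simp only [pd_castAdd, dEv, Pi.add_apply]; split_ifs <;> simp
  · simp only [pd_natAdd, dOd, Pi.add_apply]; split_ifs <;> ring

lemma pd_smul (i : Fin (m + n)) (c : F) (f : O F p m n) : pd i (c • f) = c • pd i f := by
  funext μ
  refine Fin.addCases (fun i => ?_) (fun i => ?_) i
  · simp only [pd_castAdd, dEv, Pi.smul_apply]; split_ifs <;> simp
  · simp only [pd_natAdd, dOd, Pi.smul_apply, smul_eq_mul]; split_ifs <;> ring

lemma pd_zero (i : Fin (m + n)) : pd i (0 : O F p m n) = 0 := by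
  have := pd_smul i (0 : F) (0 : O F p m n)
  simpa using this

lemma pd_xVar (hp : 3 < p) (i k : Fin (m + n)) :
    pd i (xVar k : O F p m n) = if i = k then oneO F p m n else 0 := by
  have v1' := val_one_fin hp
  have v1 : 1 % p = 1 := Nat.mod_eq_of_lt (by omega)
  funext ⟨α, s⟩
  induction i using Fin.addCases with
  | left i =>
    simp only [pd_castAdd, dEv]
    induction k using Fin.addCases with
    | left k =>
      simp only [xVar_castAdd, Fin.castAdd_inj]
      by_cases hik : i = k
      · subst hik
        simp only [if_true, oneO, Prod.mk.injEq]
        split_ifs with h1 h2 h3 h3 h3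
        · rfl
        · exfalso; apply h3; refine ⟨funext fun a => Fin.ext ?_, h2.2⟩
          have := congrArg Fin.val (congrFun h2.1 a)
          by_cases ha : a = i
          · subst ha; simp [v1] at this; simpa using this
          · simpa [ha] using this
        · exfalso; apply h2; refine ⟨funext fun a => Fin.ext ?_, h3.2⟩
          by_cases ha : a = i
          · subst ha; simp [v1, h3.1]
          · simp [ha, h3.1]
        · rfl
        · exfalso; rw [h3.1] at h1; simp at h1; omega
        · rfl
      · simp only [hik, if_false, Pi.zero_apply]
        split_ifs with h1 h2
        · exfalso
          rw [Prod.mk.injEq] at h2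
          have := congrArg Fin.val (congrFun h2.1 i)
          simp [hik] at this
        · rfl
        · rfl
    | right k =>
      have hne : Fin.castAdd n i ≠ Fin.natAdd m k := by
        intro h; have := congrArg Fin.val h; simp at this; omega
      simp only [xVar_natAdd, hne, if_false, Pi.zero_apply]
      split_ifs with h1 h2
      · exfalso
        rw [Prod.mk.injEq] at h2
        have := congrArg Fin.val (congrFun h2.1 i)
        simp at this
      · rfl
      · rfl
  | right i =>
    simp only [pd_natAdd, dOd]
    induction k using Fin.addCases with
    | left k =>
      have hne : Fin.natAdd m i ≠ Fin.castAdd n k := by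
        intro h; have := congrArg Fin.val h; simp at this; omega
      simp [xVar_castAdd, hne]
    | right k =>
      simp only [xVar_natAdd, Fin.natAdd_inj]
      by_cases hik : i = k
      · subst hik
        simp only [if_true, oneO, Prod.mk.injEq]
        by_cases hs : s = ∅
        · subst hs; simp
        · have : i ∉ s → insert i s ≠ {i} := by
            intro hi h
            apply hs
            apply Finset.eq_empty_of_forall_notMem
            intro x hx
            have : x ∈ ({i} : Finset (Fin n)) := h ▸ Finset.mem_insert_of_mem hx
            rw [Finset.mem_singleton] at this
            exact hi (this ▸ hx)
          split_ifs <;> simp_all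
      · have : insert i s ≠ {k} := by
          intro h
          have : i ∈ ({k} : Finset (Fin n)) := h ▸ Finset.mem_insert_self i s
          exact hik (Finset.mem_singleton.1 this)
        simp [hik, this]

/-- For `j ≥ 2`, `∂_j` commutes with multiplication by `x_1`. -/
lemma pd_mulO_x (hp : 3 < p) (hm : 0 < m) (h : 0 < m + n) (j : Fin (m + n))
    (hj : 1 ≤ (j : ℕ)) (f : O F p m n) :
    pd j (mulO (xVar (⟨0, h⟩ : Fin (m + n))) f) =
      mulO (xVar (⟨0, h⟩ : Fin (m + n))) (pd j f) := by
  funext ⟨α, s⟩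
  rw [mulO_x hp hm h]
  induction j using Fin.addCases with
  | left j =>
    have hne : (⟨0, hm⟩ : Fin m) ≠ j := by
      rintro rfl; simp at hj
    simp only [pd_castAdd, dEv, mulO_x hp hm h, Function.update_of_ne hne,
      Function.update_of_ne hne.symm]
    split_ifs
    · rw [Function.update_comm hne]
    · simp
  | right j =>
    simp only [pd_natAdd, dOd, mulO_x hp hm h]
    split_ifs <;> ring

/-- The variable `x_j` divides the monomial `μ`. -/
def has (j : Fin (m + n)) (μ : Mon p m n) : Prop :=
  Sum.elim (fun i => (μ.1 i : ℕ) ≠ 0) (fun i => i ∈ μ.2) (finSumFinEquiv.symm j)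

/-- The monomial `x_1^(2)`. -/
def twoMon (n : ℕ) (hp : 3 < p) (hm : 0 < m) : Mon p m n :=
  (Pi.single ⟨0, hm⟩ ⟨2, by omega⟩, ∅)

/-- The monomial `x_1 x_j`, for `j ≥ 2`. -/
def eMon (hm : 0 < m) (j : Fin (m + n)) : Mon p m n :=
  Sum.elim (fun i => (Function.update (Pi.single ⟨0, hm⟩ 1) i 1, ∅))
    (fun i => (Pi.single ⟨0, hm⟩ 1, {i})) (finSumFinEquiv.symm j)

lemma key (hp : 3 < p) (hc : CharP F p) (hm : 0 < m) (h : 0 < m + n) (j : Fin (m + n))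
    (hj : 1 ≤ (j : ℕ)) (μ : Mon p m n) (hμ : has j μ) (h0 : (μ.1 ⟨0, hm⟩ : ℕ) + 1 < p) :
    ∃ u : F, u ≠ 0 ∧ ∃ ν : Mon p m n,
      (∀ f : O F p m n, mulO (xVar (⟨0, h⟩ : Fin (m + n))) (pd j f) ν = u * f μ) ∧
      (ν = twoMon n hp hm → μ = eMon hm j) := by
  have v1' := val_one_fin hp
  have v1 : 1 % p = 1 := Nat.mod_eq_of_lt (by omega)
  obtain ⟨α, s⟩ := μ
  set i0 : Fin m := ⟨0, hm⟩ with hi0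
  have hne0 : (((α i0 : ℕ) + 1 : ℕ) : F) ≠ 0 := by
    rw [Ne, CharP.cast_eq_zero_iff F p]
    intro hd; have := Nat.le_of_dvd (by omega) hd; simp at h0; omega
  simp only at h0
  have hs1 : (⟨(α i0 : ℕ) + 1, h0⟩ : Fin p) - 1 = α i0 := by
    apply Fin.ext; rw [val_sub_one_fin hp _ (by simp)]; simp
  induction j using Fin.addCases with
  | left j =>
    have hne : i0 ≠ j := by rintro rfl; simp [hi0] at hj
    have hαj : (α j : ℕ) ≠ 0 := by simpa [has] using hμ
    have hsub := val_sub_one_fin hp _ hαj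
    refine ⟨_, hne0, (Function.update (Function.update α j (α j - 1)) i0 ⟨(α i0 : ℕ) + 1, h0⟩, s),
      ?_, ?_⟩
    · intro f
      rw [mulO_x hp hm h]
      simp only [← hi0, Function.update_self, hs1, Function.update_idem, pd_castAdd, dEv,
        Function.update_of_ne hne.symm]
      have hlt := (α j).isLt
      rw [dif_pos (by rw [hsub]; omega)]
      congr 2
      refine Prod.ext (funext fun a => Fin.ext ?_) rfl
      by_cases ha : a = j
      · subst ha; simp [hsub]; omega
      · by_cases ha' : a = i0
        · subst ha'; simp [ha]
        · simp [ha, ha']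
    · intro hν
      simp only [twoMon, Prod.mk.injEq] at hν
      simp only [eMon, finSumFinEquiv_symm_apply_castAdd, Sum.elim_inl, Prod.mk.injEq]
      refine ⟨funext fun a => Fin.ext ?_, hν.2⟩
      have := congrArg Fin.val (congrFun hν.1 a)
      by_cases ha : a = j
      · subst ha; simp [hne.symm, ← hi0, hsub] at this; simp [v1]; omega
      · by_cases ha' : a = i0
        · subst ha'; simp [← hi0] at this; simp [ha, ← hi0, v1, this]
        · simp [ha, ha', ← hi0] at this; simp [ha, ha', ← hi0, this]
  | right j =>
    have hjs : j ∈ s := by simpa [has] using hμ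
    refine ⟨(((α i0 : ℕ) + 1 : ℕ) : F) * (-1) ^ ((s.erase j).filter fun k => k < j).card,
      mul_ne_zero hne0 (pow_ne_zero _ (by simp)),
      (Function.update α i0 ⟨(α i0 : ℕ) + 1, h0⟩, s.erase j), ?_, ?_⟩
    · intro f
      rw [mulO_x hp hm h]
      simp only [← hi0, Function.update_self, hs1, Function.update_idem, pd_natAdd, dOd,
        Function.update_eq_self, Finset.notMem_erase, if_false, Finset.insert_erase hjs]
      ring
    · intro hν
      simp only [twoMon, Prod.mk.injEq] at hν
      simp only [eMon, finSumFinEquiv_symm_apply_natAdd, Sum.elim_inr, Prod.mk.injEq]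
      refine ⟨funext fun a => Fin.ext ?_, ?_⟩
      · have := congrArg Fin.val (congrFun hν.1 a)
        by_cases ha' : a = i0
        · subst ha'; simp [← hi0] at this; simp [← hi0, v1, this]
        · simp [ha', ← hi0] at this; simp [ha', ← hi0, this]
      · rw [← Finset.insert_erase hjs, hν.2]; simp

lemma key_two (hp : 3 < p) (hm : 0 < m) (h : 0 < m + n) (j : Fin (m + n))
    (hj : 1 ≤ (j : ℕ)) (f : O F p m n) :
    mulO (xVar (⟨0, h⟩ : Fin (m + n))) (pd j f) (twoMon n hp hm) = 2 * f (eMon hm j) := by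
  have v1' := val_one_fin hp
  have v1 : 1 % p = 1 := Nat.mod_eq_of_lt (by omega)
  set i0 : Fin m := ⟨0, hm⟩ with hi0
  have hs : (⟨2, by omega⟩ : Fin p) - 1 = 1 := by
    apply Fin.ext; rw [val_sub_one_fin hp _ (by simp), v1']; rfl
  rw [mulO_x hp hm h]
  induction j using Fin.addCases with
  | left j =>
    have hne : i0 ≠ j := by rintro rfl; simp [hi0] at hj
    simp only [twoMon, ← hi0, Pi.single_eq_same, hs, pd_castAdd, dEv,
      Function.update_of_ne hne.symm, Pi.single_eq_of_ne hne.symm, eMon,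
      finSumFinEquiv_symm_apply_castAdd, Sum.elim_inl]
    rw [dif_pos (by simp; omega)]
    congr 2
    refine Prod.ext (funext fun a => Fin.ext ?_) rfl
    by_cases ha : a = j
    · subst ha; simp [v1]
    · by_cases ha' : a = i0
      · subst ha'; simp [ha]
      · simp [ha, ha']
  | right j =>
    simp only [twoMon, ← hi0, Pi.single_eq_same, hs, pd_natAdd, dOd, eMon,
      finSumFinEquiv_symm_apply_natAdd, Sum.elim_inr]
    simp [Pi.single]

lemma eq_two (hp : 3 < p) (hm : 0 < m) (μ : Mon p m n) (hd : zdMon μ = 2)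
    (hh : ∀ j : Fin (m + n), 1 ≤ (j : ℕ) → ¬ has j μ) : μ = twoMon n hp hm := by
  have h1 : ∀ i : Fin m, i ≠ ⟨0, hm⟩ → (μ.1 i : ℕ) = 0 := by
    intro i hi
    have := hh (Fin.castAdd n i) (by
      by_contra hc
      apply hi; apply Fin.ext; simp at hc; simpa using hc)
    simpa [has] using this
  have h2 : μ.2 = ∅ := by
    apply Finset.eq_empty_of_forall_notMem
    intro i
    have := hh (Fin.natAdd m i) (by simp; omega)
    simpa [has] using this
  refine Prod.ext (funext fun i => Fin.ext ?_) h2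
  by_cases hi : i = ⟨0, hm⟩
  · subst hi
    rw [zdMon, h2, Finset.sum_eq_single ⟨0, hm⟩ (fun b _ hb => h1 b hb) (by simp)] at hd
    simpa [twoMon] using hd
  · simp [twoMon, hi, h1 i hi]

lemma eMon_ne (hp : 3 < p) (hm : 0 < m) (j : Fin (m + n)) (hj : 1 ≤ (j : ℕ)) :
    (eMon hm j : Mon p m n) ≠ twoMon n hp hm := by
  have v1' := val_one_fin hp
  have v1 : 1 % p = 1 := Nat.mod_eq_of_lt (by omega)
  induction j using Fin.addCases with
  | left j =>
    have hne : (⟨0, hm⟩ : Fin m) ≠ j := by rintro rfl; simp at hj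
    intro h
    have := congrArg (fun μ : Mon p m n => (μ.1 ⟨0, hm⟩ : ℕ)) h
    simp [eMon, twoMon, hne, v1] at this
  | right j =>
    intro h
    have := congrArg (fun μ : Mon p m n => μ.2) h
    simp [eMon, twoMon] at this

lemma mulO_xx (hp : 3 < p) (hm : 0 < m) (h : 0 < m + n) (μ : Mon p m n) :
    mulO (xVar (⟨0, h⟩ : Fin (m + n))) (xVar (⟨0, h⟩ : Fin (m + n)) : O F p m n) μ =
      if μ = twoMon n hp hm then 2 else 0 := by
  have v1' := val_one_fin hp
  have v1 : 1 % p = 1 := Nat.mod_eq_of_lt (by omega)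
  rw [mulO_x hp hm h, xVar_zero hm h]
  set i0 : Fin m := ⟨0, hm⟩ with hi0
  have hs : (⟨2, by omega⟩ : Fin p) - 1 = 1 := by
    apply Fin.ext; rw [val_sub_one_fin hp _ (by simp), v1']; rfl
  split_ifs with h1 h2 h2
  · subst h2; simp [twoMon, ← hi0]
  · by_cases h0 : (μ.1 i0 : ℕ) = 0
    · simp [h0]
    · exfalso
      apply h2
      rw [Prod.mk.injEq] at h1
      refine Prod.ext (funext fun a => Fin.ext ?_) h1.2
      have := congrArg Fin.val (congrFun h1.1 a)
      by_cases ha : a = i0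
      · subst ha; simp [v1, val_sub_one_fin hp _ h0] at this; simp [twoMon, ← hi0]; omega
      · simp [ha] at this; simp [twoMon, ← hi0, ha, this]
  · exfalso; apply h1; subst h2
    simp only [twoMon, ← hi0, Pi.single_eq_same, hs]
    simp [Pi.single]
  · simp

lemma mulO_xk (hp : 3 < p) (hm : 0 < m) (h : 0 < m + n) (k : Fin (m + n))
    (hk : 1 ≤ (k : ℕ)) (μ : Mon p m n) :
    mulO (xVar (⟨0, h⟩ : Fin (m + n))) (xVar k : O F p m n) μ =
      if μ = eMon hm k then 1 else 0 := by
  have v1' := val_one_fin hp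
  have v1 : 1 % p = 1 := Nat.mod_eq_of_lt (by omega)
  rw [mulO_x hp hm h]
  obtain ⟨α, s⟩ := μ
  set i0 : Fin m := ⟨0, hm⟩ with hi0
  simp only
  by_cases h0 : (α i0 : ℕ) = 0
  · rw [h0, if_neg]
    · simp
    · intro he
      have he := congrArg (fun μ : Mon p m n => (μ.1 i0 : ℕ)) he
      induction k using Fin.addCases with
      | left j =>
        have hne : i0 ≠ j := by rintro rfl; simp [hi0] at hk
        simp [eMon, hne, ← hi0, v1, h0] at he
      | right j => simp [eMon, ← hi0, v1, h0] at he
  have hsub := val_sub_one_fin hp _ h0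
  have hiff : (α i0 : ℕ) = 1 ∧ (xVar k : O F p m n) (Function.update α i0 (α i0 - 1), s) = 1 ∧
      (α, s) = eMon hm k ∨ (xVar k : O F p m n) (Function.update α i0 (α i0 - 1), s) = 0 ∧
      (α, s) ≠ eMon hm k := by
    induction k using Fin.addCases with
    | left j =>
      have hne : i0 ≠ j := by rintro rfl; simp [hi0] at hk
      rw [xVar_castAdd]
      simp only [eMon, finSumFinEquiv_symm_apply_castAdd, Sum.elim_inl, Prod.mk.injEq, ne_eq]
      by_cases hc : Function.update α i0 (α i0 - 1) = Pi.single j 1 ∧ s = ∅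
      · left
        have h00 := congrArg Fin.val (congrFun hc.1 i0)
        simp [hne, hsub] at h00
        refine ⟨by omega, by rw [if_pos hc], funext fun a => Fin.ext ?_, hc.2⟩
        have := congrArg Fin.val (congrFun hc.1 a)
        by_cases ha : a = i0
        · subst ha; simp [hne, ← hi0, v1]; omega
        · by_cases ha' : a = j
          · subst ha'; simp [ha] at this; simp [this]
          · simp [ha, ha'] at this; simp [ha, ha', ← hi0, this]
      · right
        refine ⟨by rw [if_neg hc], fun hd => hc ⟨?_, hd.2⟩⟩
        rw [hd.1]
        funext a
        by_cases ha : a = i0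
        · subst ha; simp [hne, ← hi0]
        · by_cases ha' : a = j
          · subst ha'; simp [ha]
          · simp [ha, ha', ← hi0]
    | right j =>
      rw [xVar_natAdd]
      simp only [eMon, finSumFinEquiv_symm_apply_natAdd, Sum.elim_inr, Prod.mk.injEq, ne_eq]
      by_cases hc : Function.update α i0 (α i0 - 1) = 0 ∧ s = {j}
      · left
        have h00 := congrArg Fin.val (congrFun hc.1 i0)
        rw [Function.update_self, hsub] at h00
        simp at h00
        refine ⟨by omega, by rw [if_pos hc], funext fun a => Fin.ext ?_, hc.2⟩
        have := congrArg Fin.val (congrFun hc.1 a)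
        by_cases ha : a = i0
        · subst ha; simp [← hi0, v1]; omega
        · simp [ha] at this; simp [ha, ← hi0, this]
      · right
        refine ⟨by rw [if_neg hc], fun hd => hc ⟨?_, hd.2⟩⟩
        rw [hd.1]
        funext a
        by_cases ha : a = i0
        · subst ha; simp [← hi0]
        · simp [ha, ← hi0]
  rcases hiff with ⟨a, b, c⟩ | ⟨b, c⟩
  · rw [a, b, if_pos c]; simp
  · rw [b, if_neg c]; simp

lemma bracket_formula (hp : 3 < p) (hm : 0 < m) (h : 0 < m + n) (j k : Fin (m + n))
    (D : W F p m n) :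
    bracketW ((fun k => if k = j then xVar (⟨0, h⟩ : Fin (m + n)) else 0) : W F p m n) D k =
      mulO (xVar (⟨0, h⟩ : Fin (m + n))) (pd j (D k)) -
        if k = j then ∑ b : ZMod 2, ((-1 : F)) ^ (parIdx m j * b).val • projO b (D ⟨0, h⟩)
        else 0 := by
  set z : Fin (m + n) := ⟨0, h⟩ with hz
  set X : W F p m n := fun k => if k = j then xVar z else 0 with hX
  have hpx : ∀ c : ZMod 2, projO c (xVar z : O F p m n) = if c = 0 then xVar z else 0 := by
    intro c
    funext μ
    simp only [projO, hz, xVar_zero hm h]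
    by_cases hμ : μ = (Pi.single ⟨0, hm⟩ 1, ∅)
    · subst hμ
      by_cases hc : c = 0
      · simp [hc, parMon, xVar_zero hm h]
      · simp [hc, parMon, Ne.symm hc]
    · split_ifs <;> simp [xVar_zero hm h, hμ]
  have hpX : ∀ a : ZMod 2, projW a X = if a = parIdx m j then X else 0 := by
    intro a
    have h2 : a + parIdx m j = 0 ↔ a = parIdx m j := by
      generalize parIdx m j = q; revert a q; decide
    funext i
    simp only [projW, hX]
    by_cases hi : i = j
    · subst hi
      rw [if_pos rfl, hpx]
      by_cases ha : a = parIdx m i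
      · rw [if_pos (h2.2 ha), if_pos ha]; simp
      · rw [if_neg (fun hh => ha (h2.1 hh)), if_neg ha]; simp
    · rw [if_neg hi]
      split_ifs <;> funext μ <;> simp [projO, hi]
  have hactX : ∀ g, act X g = mulO (xVar z) (pd j g) := by
    intro g
    unfold act
    rw [Finset.sum_eq_single j]
    · simp [hX]
    · intro b _ hb; simp [hX, hb, zero_mulO]
    · simp
  have hact0 : ∀ g : O F p m n, act (0 : W F p m n) g = 0 := by
    intro g; simp [act, zero_mulO]
  have hact0' : ∀ E : W F p m n, act E 0 = 0 := by
    intro g; simp [act, mulO_zero, pd_zero]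
  have hactz : ∀ E : W F p m n, act E (xVar z) = E z := by
    intro E
    unfold act
    rw [Finset.sum_eq_single z]
    · rw [pd_xVar hp, if_pos rfl, mulO_one]
    · intro b _ hb; rw [pd_xVar hp, if_neg hb, mulO_zero]
    · simp
  have hsplit : ∀ f : O F p m n, ∀ q : ZMod 2, projO (0 + q) f + projO (1 + q) f = f := by
    intro f q
    funext μ
    simp only [projO, Pi.add_apply]
    generalize parMon μ = r
    have : (r = 0 + q ∧ r ≠ 1 + q) ∨ (r ≠ 0 + q ∧ r = 1 + q) := by revert q r; decide
    rcases this with ⟨a, b⟩ | ⟨a, b⟩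
    · rw [if_pos a, if_neg b, add_zero]
    · rw [if_neg a, if_pos b, zero_add]
  have hsum : ∀ f : ZMod 2 → O F p m n, ∑ b : ZMod 2, f b = f 0 + f 1 := fun f =>
    Fin.sum_univ_two f
  unfold bracketW
  rw [Finset.sum_eq_single (parIdx m j)]
  · rw [hpX, if_pos rfl, Finset.sum_apply, Finset.sum_sub_distrib]
    congr 1
    · simp only [hactX]
      rw [hsum, ← mulO_x_add hp hm h, ← pd_add]
      simp only [projW]
      rw [hsplit]
    · by_cases hk : k = j
      · rw [if_pos hk]
        simp only [hX, if_pos hk, hactz, projW]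
        refine Finset.sum_congr rfl fun b _ => ?_
        have : parIdx m z = 0 := by simp [parIdx, hz, hm]
        rw [this, add_zero]
      · rw [if_neg hk]
        simp only [hX, if_neg hk, hact0', smul_zero, Finset.sum_const_zero]
  · intro a _ ha
    apply Finset.sum_eq_zero
    intro b _
    rw [hpX, if_neg ha]
    funext k
    simp [hact0, hact0']
  · simp

lemma sigma_apply (q : ZMod 2) (f : O F p m n) (μ : Mon p m n) (hμ : f μ ≠ 0 → parMon μ = 0) :
    (∑ b : ZMod 2, ((-1 : F)) ^ (q * b).val • projO b f) μ = f μ := by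
  have hsum : ∑ b : ZMod 2, ((-1 : F)) ^ (q * b).val • projO b f =
      ((-1 : F)) ^ (q * 0).val • projO 0 f + ((-1 : F)) ^ (q * 1).val • projO 1 f :=
    Fin.sum_univ_two (fun b : ZMod 2 => ((-1 : F)) ^ (q * b).val • projO b f)
  rw [hsum]
  by_cases h0 : f μ = 0
  · simp [projO, h0]
  · simp [projO, hμ h0]

end Helpers

/-- for `D ∈ W_1`, `[x_1∂_j, D] = 0` for all `j ≥ 2` iff
`D = λ·x_1𝔇 + x_1²·∑_{j≥2} k_j ∂_j` for some scalars `λ, k_j`. -/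
theorem bracket_x1dj_eq_zero_iff (F : Type*) [Field F] (p m n : ℕ) [Fact p.Prime]
    [CharP F p] (hp : 3 < p) (hm : 2 ≤ m) (hn : 2 ≤ n)
    (D : W F p m n) (hD : inW 1 D) :
    (∀ j : Fin (m + n), 1 ≤ (j : ℕ) →
        bracketW
          ((fun k => if k = j then xVar (⟨0, by omega⟩ : Fin (m + n)) else 0) : W F p m n)
          D = 0)
    ↔ ∃ (lam : F) (kk : Fin (m + n) → F),
        D = lam • fEuler (xVar (⟨0, by omega⟩ : Fin (m + n))) +
          (fun j : Fin (m + n) => if 1 ≤ (j : ℕ) then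
              kk j • mulO (xVar (⟨0, by omega⟩ : Fin (m + n)))
                (xVar (⟨0, by omega⟩ : Fin (m + n)))
            else 0) := by
  have hm0 : 0 < m := by omega
  have h : 0 < m + n := by omega
  have h2 : (2 : F) ≠ 0 := by
    have : ((2 : ℕ) : F) ≠ 0 := by
      rw [Ne, CharP.cast_eq_zero_iff F p]
      intro hd; have := Nat.le_of_dvd (by omega) hd; omega
    simpa using this
  have hz : ∀ k : Fin (m + n), ¬ 1 ≤ (k : ℕ) → k = ⟨0, h⟩ := by
    intro k hk; apply Fin.ext; simp; omega
  have hpar : parMon (twoMon n hp hm0) = 0 := by simp [parMon, twoMon]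
  constructor
  · intro H
    have H' : ∀ j k : Fin (m + n), 1 ≤ (j : ℕ) → ∀ μ,
        mulO (xVar (⟨0, h⟩ : Fin (m + n))) (pd j (D k)) μ = (if k = j then
          ∑ b : ZMod 2, ((-1 : F)) ^ (parIdx m j * b).val • projO b (D ⟨0, h⟩) else 0) μ := by
      intro j k hj μ
      have := congrFun (congrFun (H j hj) k) μ
      rw [bracket_formula hp hm0 h] at this
      exact sub_eq_zero.1 this
    have hdeg : ∀ k μ, D k μ ≠ 0 → zdMon μ = 2 := by
      intro k μ hne
      have := hD k μ hne
      omega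
    have hlt : ∀ μ : Mon p m n, zdMon μ = 2 → (μ.1 ⟨0, hm0⟩ : ℕ) + 1 < p := by
      intro μ hμ
      have : (μ.1 ⟨0, hm0⟩ : ℕ) ≤ ∑ i, (μ.1 i : ℕ) :=
        Finset.single_le_sum (f := fun i => (μ.1 i : ℕ)) (fun _ _ => Nat.zero_le _)
          (Finset.mem_univ _)
      unfold zdMon at hμ
      omega
    have hD0 : ∀ μ, D ⟨0, h⟩ μ ≠ 0 → μ = twoMon n hp hm0 := by
      intro μ hne
      refine eq_two hp hm0 μ (hdeg _ _ hne) ?_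
      intro j hj hh
      obtain ⟨u, hu, ν, hν, -⟩ := key (F := F) hp inferInstance hm0 h j hj μ hh
        (hlt μ (hdeg _ _ hne))
      have := H' j ⟨0, h⟩ hj ν
      rw [hν, if_neg (by rintro rfl; simp at hj)] at this
      exact (mul_ne_zero hu hne) this
    have hsig : ∀ q μ, (∑ b : ZMod 2, ((-1 : F)) ^ (q * b).val • projO b (D ⟨0, h⟩)) μ =
        D ⟨0, h⟩ μ := fun q μ => sigma_apply q _ μ (fun hne => hD0 μ hne ▸ hpar)
    refine ⟨D ⟨0, h⟩ (twoMon n hp hm0) / 2, fun j => D j (twoMon n hp hm0) / 2, ?_⟩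
    funext k μ
    simp only [Pi.add_apply, Pi.smul_apply, smul_eq_mul, fEuler]
    by_cases hk : 1 ≤ (k : ℕ)
    · rw [if_pos hk, mulO_xk hp hm0 h k hk, Pi.smul_apply, mulO_xx hp hm0 h, smul_eq_mul]
      by_cases h1 : μ = twoMon n hp hm0
      · rw [if_neg (fun he => eMon_ne hp hm0 k hk (he.symm.trans h1)), if_pos h1, h1]
        field_simp; simp
      · rw [if_neg h1]
        by_cases h3 : μ = eMon hm0 k
        · rw [if_pos h3, h3]
          have := H' k k hk (twoMon n hp hm0)
          rw [key_two hp hm0 h k hk, if_pos rfl, hsig] at this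
          rw [← this]; field_simp; simp
        · rw [if_neg h3]
          by_contra hne
          have hne : D k μ ≠ 0 := by simpa using hne
          apply h1
          refine eq_two hp hm0 μ (hdeg _ _ hne) ?_
          intro j hj hh
          obtain ⟨u, hu, ν, hν, hν'⟩ := key (F := F) hp inferInstance hm0 h j hj μ hh
            (hlt μ (hdeg _ _ hne))
          have := H' j k hj ν
          rw [hν] at this
          apply mul_ne_zero hu hne
          rw [this]
          by_cases hkj : k = j
          · subst hkj
            rw [if_pos rfl, hsig]
            by_contra hne'
            exact h3 (hν' (hD0 ν hne'))
          · rw [if_neg hkj]; rfl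
    · rw [if_neg hk, hz k hk, mulO_xx hp hm0 h]
      by_cases h1 : μ = twoMon n hp hm0
      · rw [if_pos h1, h1]; field_simp; simp
      · rw [if_neg h1]
        by_contra hne
        exact h1 (hD0 μ (by simpa using hne))
  · rintro ⟨lam, kk, rfl⟩ j hj
    funext k
    rw [bracket_formula hp hm0 h, Pi.zero_apply, sub_eq_zero]
    have hjz : j ≠ ⟨0, h⟩ := by rintro rfl; simp at hj
    have hx1 : pd j (mulO (xVar (⟨0, h⟩ : Fin (m + n))) (xVar (⟨0, h⟩ : Fin (m + n))) :
        O F p m n) = 0 := by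
      rw [pd_mulO_x hp hm0 h j hj, pd_xVar hp, if_neg hjz, mulO_zero]
    have hs : pd j (if 1 ≤ (k : ℕ) then kk k • mulO (xVar (⟨0, h⟩ : Fin (m + n)))
        (xVar (⟨0, h⟩ : Fin (m + n))) else 0 : O F p m n) = 0 := by
      split_ifs
      · rw [pd_smul, hx1, smul_zero]
      · exact pd_zero j
    rw [Pi.add_apply, pd_add, hs, add_zero, Pi.smul_apply, pd_smul, fEuler,
      pd_mulO_x hp hm0 h j hj, pd_xVar hp]
    by_cases hk : k = j
    · subst hk
      rw [if_pos rfl, if_pos rfl, mulO_one, mulO_x_smul hp hm0 h]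
      funext μ
      have e0 : ((lam • fEuler (xVar (⟨0, h⟩ : Fin (m + n))) +
          (fun j : Fin (m + n) => if 1 ≤ (j : ℕ) then
              kk j • mulO (xVar (⟨0, h⟩ : Fin (m + n))) (xVar (⟨0, h⟩ : Fin (m + n)))
            else 0) : W F p m n) ⟨0, h⟩) =
          lam • mulO (xVar (⟨0, h⟩ : Fin (m + n))) (xVar (⟨0, h⟩ : Fin (m + n))) := by
        simp [fEuler]
      rw [e0, sigma_apply]
      intro hne
      rw [Pi.smul_apply, mulO_xx hp hm0 h] at hne
      by_cases h1 : μ = twoMon n hp hm0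
      · rw [h1, hpar]
      · simp [h1] at hne
    · rw [if_neg (Ne.symm hk), if_neg hk, mulO_zero, smul_zero, mulO_zero]

end Cartan
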